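/- arXiv:1611.06379 — 2 statements merged into one kernel-verified Lean document; each statement's English description precedes it below -/
import Mathlib

section
/- Let d, h ∈ ℝ³ with (d,h) ≠ (0,0), and regard F = F(d,h) as a 4×4 complex matrix. Then: (a) the characteristic polynomial of F equals X⁴ (i.e., 0 is a quadruple eigenvalue) if and only if d·h = 0 and ‖d‖ = ‖h‖ (F is then called hyper-singular); (b) F is diagonalizable over ℂ if and only if F is not hyper-singular, i.e., if and only if not both d·h = 0 and ‖d‖ = ‖h‖ hold. -/
open Matrix Polynomial

/-- The 4×4 `G`-skew symmetric matrix `F(d,h) = [[0, dᵀ],[d, V(h)]]`, where `V(h)` is the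
matrix of `u ↦ u × h`. -/
def Fmat (d h : Fin 3 → ℝ) : Matrix (Fin 4) (Fin 4) ℝ :=
  !![0,   d 0,    d 1,    d 2;
     d 0, 0,      h 2,    -h 1;
     d 1, -h 2,   0,      h 0;
     d 2, h 1,    -h 0,   0]

theorem Fmat_charpoly (d h : Fin 3 → ℝ) :
    (Fmat d h).charpoly =
      X ^ 4 - C (d ⬝ᵥ d - h ⬝ᵥ h) * X ^ 2 - C ((d ⬝ᵥ h) ^ 2) := by
  simp only [Matrix.charpoly, Matrix.charmatrix, Fmat, dotProduct,
    Matrix.det_succ_row_zero, Fin.sum_univ_succ]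
  simp [Fin.succAbove, Matrix.det_fin_zero]
  ring

theorem Fmat_pow_three_of_dotProduct_eq_zero (d h : Fin 3 → ℝ) (hdh : d ⬝ᵥ h = 0) :
    Fmat d h ^ 3 = (d ⬝ᵥ d - h ⬝ᵥ h) • Fmat d h := by
  simp only [dotProduct, Fin.sum_univ_three] at hdh ⊢
  ext i j
  fin_cases i <;> fin_cases j <;>
    simp [Fmat, pow_succ, Matrix.mul_apply, Fin.sum_univ_four] <;> grind

theorem Fmat_eq_zero_iff (d h : Fin 3 → ℝ) : Fmat d h = 0 ↔ d = 0 ∧ h = 0 := by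
  constructor
  · intro hF
    have e (i j : Fin 4) : Fmat d h i j = 0 := by rw [hF]; rfl
    have e1 := e 0 1
    have e2 := e 0 2
    have e3 := e 0 3
    have e4 := e 2 3
    have e5 := e 3 1
    have e6 := e 1 2
    simp only [Fmat, Matrix.of_apply, Matrix.cons_val] at e1 e2 e3 e4 e5 e6
    constructor <;> ext i <;> fin_cases i <;> assumption
  · rintro ⟨rfl, rfl⟩
    ext i j
    fin_cases i <;> fin_cases j <;> simp [Fmat]

theorem separable_biquadratic {t s : ℝ} (hs : s ≠ 0) :
    (X ^ 4 - C t * X ^ 2 - C (s ^ 2) : ℝ[X]).Separable := by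
  have hD : 2 * s ^ 2 * (t ^ 2 + 4 * s ^ 2) ≠ 0 := by positivity
  rw [separable_def']
  set k := (2 * s ^ 2 * (t ^ 2 + 4 * s ^ 2))⁻¹ with hk
  have hk1 : C k * (2 * C s ^ 2 * (C t ^ 2 + 4 * C s ^ 2)) = 1 := by
    have := congrArg C (inv_mul_cancel₀ hD)
    simpa only [← hk, map_mul, map_add, map_pow, map_ofNat, map_one] using this
  refine ⟨-C k * (8 * (X ^ 4 - C t * X ^ 2 - C (s ^ 2)) + 2 * (C t ^ 2 + 4 * C s ^ 2)
    + 8 * C s ^ 2), C k * (X * (X ^ 2 - C t) * (2 * X ^ 2 - C t)), ?_⟩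
  simp only [derivative_sub, derivative_mul, derivative_X_pow, derivative_C]
  simp only [Nat.cast_ofNat, map_ofNat, map_pow C]
  linear_combination hk1

theorem separable_X_pow_three_sub {t : ℝ} (ht : t ≠ 0) :
    (X ^ 3 - C t * X : ℝ[X]).Separable := by
  have hD : -2 * t ^ 2 ≠ 0 := by simpa using ht
  rw [separable_def']
  set k := (-2 * t ^ 2)⁻¹ with hk
  have hk1 : C k * (-2 * C t ^ 2) = 1 := by
    have := congrArg C (inv_mul_cancel₀ hD)
    simpa only [← hk, map_mul, map_neg, map_pow, map_ofNat, map_one] using this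
  refine ⟨C k * (9 * X), C k * (2 * C t - 3 * X ^ 2), ?_⟩
  simp only [derivative_sub, derivative_mul, derivative_X_pow, derivative_C, derivative_X,
    Nat.cast_ofNat, map_ofNat]
  linear_combination hk1

/-- A matrix over an algebraically closed field annihilated by a squarefree polynomial is
diagonalizable. -/
theorem exists_isDiag_of_squarefree_aeval_eq_zero {K n : Type*} [Field K] [IsAlgClosed K]
    [Fintype n] [DecidableEq n] {A : Matrix n n K} {p : K[X]} (hp : Squarefree p)
    (hA : aeval A p = 0) :
    ∃ P : Matrix n n K, IsUnit P.det ∧ (P⁻¹ * A * P).IsDiag := by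
  set f : Module.End K (n → K) := Matrix.toLinAlgEquiv' A with hf
  have hss : f.IsSemisimple := by
    refine Module.End.isSemisimple_of_squarefree_aeval_eq_zero hp ?_
    rw [hf, ← AlgEquiv.coe_toAlgHom, Polynomial.aeval_algHom_apply, hA, map_zero]
  have hspan : ⊤ ≤ Submodule.span K {v : n → K | ∃ μ : K, A *ᵥ v = μ • v} := by
    rw [← hss.iSup_eigenspace_eq_top]
    refine iSup_le fun μ v hv => Submodule.subset_span ⟨μ, ?_⟩
    simpa [hf] using Module.End.mem_eigenspace_iff.mp hv
  let b₀ := Module.Basis.ofSpan hspan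
  let b := b₀.reindex (b₀.indexEquiv (Pi.basisFun K n))
  have hb (j : n) : ∃ μ : K, A *ᵥ b j = μ • b j := by
    simp only [b, Module.Basis.reindex_apply]
    exact Module.Basis.ofSpan_subset hspan (Set.mem_range_self _)
  choose μ hμ using hb
  let P := (Pi.basisFun K n).toMatrix b
  have hP : IsUnit P.det := by
    have := (Pi.basisFun K n).invertibleToMatrix b
    exact Matrix.isUnit_det_of_invertible P
  have hAP : A * P = P * diagonal μ := by
    ext i j
    have := congrFun (hμ j) i
    simpa [P, Matrix.mul_apply (M := A), Matrix.mulVec, dotProduct,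
      Module.Basis.toMatrix_apply, Matrix.mul_diagonal, mul_comm (μ j)] using this
  refine ⟨P, hP, ?_⟩
  rw [Matrix.mul_assoc, hAP, Matrix.nonsing_inv_mul_cancel_left _ _ hP]
  exact Matrix.isDiag_diagonal μ

/-- A diagonalizable nilpotent matrix over a reduced ring is zero. -/
theorem eq_zero_of_isDiag_of_pow_eq_zero {K n : Type*} [CommRing K] [IsReduced K]
    [Fintype n] [DecidableEq n] {A P : Matrix n n K} (hP : IsUnit P.det)
    (hD : (P⁻¹ * A * P).IsDiag) {k : ℕ} (hA : A ^ k = 0) : A = 0 := by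
  obtain ⟨v, hv⟩ : ∃ v, P⁻¹ * A * P = diagonal v := ⟨_, hD.diagonal_diag.symm⟩
  have hAP : A * P = P * diagonal v := by
    rw [← hv, Matrix.mul_assoc, Matrix.mul_nonsing_inv_cancel_left _ _ hP]
  have hpow (m : ℕ) : A ^ m * P = P * diagonal v ^ m := by
    induction m with
    | zero => simp
    | succ m ih => rw [pow_succ, Matrix.mul_assoc, hAP, ← Matrix.mul_assoc, ih, Matrix.mul_assoc,
        pow_succ]
  have hv0 : diagonal v ^ k = 0 := by
    rw [← Matrix.nonsing_inv_mul_cancel_left P (diagonal v ^ k) hP, ← hpow, hA]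
    simp
  have hv1 : v = 0 := by
    rw [Matrix.diagonal_pow, Matrix.diagonal_eq_zero] at hv0
    exact eq_zero_of_pow_eq_zero hv0
  rw [← Matrix.mul_nonsing_inv_cancel_right P A hP, hAP, hv1]
  simp

theorem Fmat_charpoly_eq_X_pow_four_iff (d h : Fin 3 → ℝ) :
    (Fmat d h).charpoly = X ^ 4 ↔ (d ⬝ᵥ h = 0 ∧ d ⬝ᵥ d = h ⬝ᵥ h) := by
  rw [Fmat_charpoly]
  constructor
  · intro e
    have e0 := congrArg (fun p => coeff p 0) e
    have e2 := congrArg (fun p => coeff p 2) e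
    simp only [coeff_sub, coeff_C_mul, coeff_C, coeff_X_pow] at e0 e2
    norm_num at e0 e2
    exact ⟨e0, by linarith⟩
  · rintro ⟨h1, h2⟩
    simp [h1, h2]

/-- For `(d,h) ≠ (0,0)`, regarding `F(d,h)` as a complex matrix: `0` is a quadruple
eigenvalue (charpoly `= X⁴`) iff `d·h = 0` and `‖d‖ = ‖h‖` (hyper-singularity), and
`F(d,h)` is diagonalizable over `ℂ` iff it is not hyper-singular. -/
theorem hyperSingular_iff_charpoly_and_diagonalizable (d h : Fin 3 → ℝ)
    (hne : ¬(d = 0 ∧ h = 0)) :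
    (((Fmat d h).map Complex.ofReal).charpoly = X ^ 4 ↔
      (d ⬝ᵥ h = 0 ∧ d ⬝ᵥ d = h ⬝ᵥ h)) ∧
    ((∃ P : Matrix (Fin 4) (Fin 4) ℂ,
        IsUnit P.det ∧ (P⁻¹ * (Fmat d h).map Complex.ofReal * P).IsDiag) ↔
      ¬(d ⬝ᵥ h = 0 ∧ d ⬝ᵥ d = h ⬝ᵥ h)) := by
  have hmap : (Fmat d h).map Complex.ofReal = (Algebra.ofId ℝ ℂ).mapMatrix (Fmat d h) := rfl
  refine ⟨?_, ?_, fun hns => ?_⟩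
  · rw [← Fmat_charpoly_eq_X_pow_four_iff]
    have hc := Matrix.charpoly_map (Fmat d h) Complex.ofRealHom
    change ((Fmat d h).map Complex.ofReal).charpoly = _ at hc
    rw [hc, ← (Polynomial.map_injective _ Complex.ofRealHom.injective).eq_iff]
    simp
  · rintro ⟨P, hP, hD⟩ ⟨h1, h2⟩
    have h3 : (Fmat d h) ^ 3 = 0 := by
      rw [Fmat_pow_three_of_dotProduct_eq_zero d h h1, h2, sub_self, zero_smul]
    have h0 := eq_zero_of_isDiag_of_pow_eq_zero (k := 3) hP hD
      (by rw [hmap, ← map_pow, h3, map_zero])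
    refine hne ((Fmat_eq_zero_iff d h).mp ?_)
    exact Matrix.map_injective Complex.ofReal_injective (h0.trans (by ext; simp))
  · obtain ⟨p, hp, hF⟩ : ∃ p : ℝ[X], p.Separable ∧ aeval (Fmat d h) p = 0 := by
      by_cases h1 : d ⬝ᵥ h = 0
      · refine ⟨_, separable_X_pow_three_sub
          (sub_ne_zero.mpr fun h2 => hns ⟨h1, h2⟩), ?_⟩
        simp [Fmat_pow_three_of_dotProduct_eq_zero d h h1, Algebra.smul_def]
      · refine ⟨_, separable_biquadratic (t := d ⬝ᵥ d - h ⬝ᵥ h) h1, ?_⟩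
        rw [← Fmat_charpoly, Matrix.aeval_self_charpoly]
    refine exists_isDiag_of_squarefree_aeval_eq_zero
      (hp.map (f := algebraMap ℝ ℂ)).squarefree ?_
    rw [aeval_map_algebraMap, hmap, Polynomial.aeval_algHom_apply, hF, map_zero]
end

section
/- Let d, h ∈ ℝ³, F = F(d,h), F̃ = F(h,−d), and let σ, θ ∈ ℝ be normalized admissible parameters: σ² − θ² = ‖d‖² − ‖h‖², σθ = d·h, and σ² + θ² = 1. Set Z := θF − σF̃ and Z̃ := σF + θF̃. Then: (a) Z³ = −Z; (b) Z̃³ = Z̃; (c) Z·Z̃ = Z̃·Z = 0; moreover Z² = F² − σ²·I and Z̃² = F² + θ²·I, and F = θZ + σZ̃. -/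
open Matrix

/-- `F(d,h)` and its skew conjugate multiply to `(d·h)·I`. -/
theorem Fmat_mul_skewConj (d h : Fin 3 → ℝ) :
    Fmat d h * Fmat h (-d) = (d ⬝ᵥ h) • (1 : Matrix (Fin 4) (Fin 4) ℝ) := by
  ext i j
  fin_cases i <;> fin_cases j <;>
    simp [Fmat, Matrix.mul_apply, Fin.sum_univ_four, dotProduct, Fin.sum_univ_three] <;> ring

/-- The skew conjugate of `F(d,h)` and `F(d,h)` multiply to `(d·h)·I`. -/
theorem skewConj_mul_Fmat (d h : Fin 3 → ℝ) :
    Fmat h (-d) * Fmat d h = (d ⬝ᵥ h) • (1 : Matrix (Fin 4) (Fin 4) ℝ) := by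
  ext i j
  fin_cases i <;> fin_cases j <;>
    simp [Fmat, Matrix.mul_apply, Fin.sum_univ_four, dotProduct, Fin.sum_univ_three] <;> ring

/-- The squares of `F(d,h)` and its skew conjugate differ by `(‖d‖² - ‖h‖²)·I`. -/
theorem Fmat_mul_self_sub_skewConj_mul_self (d h : Fin 3 → ℝ) :
    Fmat d h * Fmat d h - Fmat h (-d) * Fmat h (-d) =
      (d ⬝ᵥ d - h ⬝ᵥ h) • (1 : Matrix (Fin 4) (Fin 4) ℝ) := by
  ext i j
  fin_cases i <;> fin_cases j <;>
    simp [Fmat, dotProduct, Fin.sum_univ_three] <;> ring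

/-- For normalized admissible parameters `σ, θ` of `F = F(d,h)` and `F̃ = F(h,−d)`, the
matrices `Z = θF − σF̃`, `Z̃ = σF + θF̃` satisfy `Z³ = −Z`, `Z̃³ = Z̃`, `Z·Z̃ = Z̃·Z = 0`,
`Z² = F² − σ²·I`, `Z̃² = F² + θ²·I`, and `F = θZ + σZ̃`. -/
theorem Z_Ztilde_relations (d h : Fin 3 → ℝ) (σ θ : ℝ)
    (h1 : σ ^ 2 - θ ^ 2 = d ⬝ᵥ d - h ⬝ᵥ h)
    (h2 : σ * θ = d ⬝ᵥ h)
    (h3 : σ ^ 2 + θ ^ 2 = 1) :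
    ∀ F Ft Z Zt : Matrix (Fin 4) (Fin 4) ℝ,
      F = Fmat d h → Ft = Fmat h (-d) → Z = θ • F - σ • Ft → Zt = σ • F + θ • Ft →
      Z ^ 3 = -Z ∧ Zt ^ 3 = Zt ∧ Z * Zt = 0 ∧ Zt * Z = 0 ∧
      Z ^ 2 = F ^ 2 - σ ^ 2 • (1 : Matrix (Fin 4) (Fin 4) ℝ) ∧
      Zt ^ 2 = F ^ 2 + θ ^ 2 • (1 : Matrix (Fin 4) (Fin 4) ℝ) ∧
      F = θ • Z + σ • Zt := by
  intro F Ft Z Zt hF hFt hZ hZt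
  have hFFt : F * Ft = (σ * θ) • 1 := by rw [hF, hFt, h2, Fmat_mul_skewConj]
  have hFtF : Ft * F = (σ * θ) • 1 := by rw [hF, hFt, h2, skewConj_mul_Fmat]
  have hFtFt : Ft * Ft = F * F - (σ ^ 2 - θ ^ 2) • 1 := by
    rw [hF, hFt, h1, ← Fmat_mul_self_sub_skewConj_mul_self, sub_sub_cancel]
  have hθ : θ ^ 2 = 1 - σ ^ 2 := by linarith
  have hZZt : Z * Zt = 0 := by
    simp only [hZ, hZt, sub_mul, mul_add, smul_mul_assoc, mul_smul_comm, hFFt, hFtF, hFtFt]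
    module
  have hZtZ : Zt * Z = 0 := by
    simp only [hZ, hZt, add_mul, mul_sub, smul_mul_assoc, mul_smul_comm, hFFt, hFtF, hFtFt]
    module
  have hZ2 : Z ^ 2 = F ^ 2 - σ ^ 2 • (1 : Matrix (Fin 4) (Fin 4) ℝ) := by
    rw [pow_two, pow_two F]
    simp only [hZ, sub_mul, mul_sub, smul_mul_assoc, mul_smul_comm,
      hFFt, hFtF, hFtFt]
    match_scalars
    · linear_combination h3
    · linear_combination -σ ^ 2 * h3
  have hZt2 : Zt ^ 2 = F ^ 2 + θ ^ 2 • (1 : Matrix (Fin 4) (Fin 4) ℝ) := by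
    rw [pow_two, pow_two F]
    simp only [hZt, add_mul, mul_add, smul_mul_assoc, mul_smul_comm,
      hFFt, hFtF, hFtFt]
    match_scalars
    · linear_combination h3
    · linear_combination θ ^ 2 * h3
  have hdiff : Zt ^ 2 = Z ^ 2 + 1 := by
    rw [hZt2, hZ2, hθ]
    module
  refine ⟨?_, ?_, hZZt, hZtZ, hZ2, hZt2, ?_⟩
  · have h0 : Z * Zt ^ 2 = 0 := by rw [pow_two, ← mul_assoc, hZZt, zero_mul]
    rw [hdiff, mul_add, mul_one, ← pow_succ'] at h0
    exact eq_neg_of_add_eq_zero_left h0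
  · rw [pow_succ', hdiff, mul_add, pow_two, ← mul_assoc, hZtZ, zero_mul, zero_add, mul_one]
  · rw [hZ, hZt]
    match_scalars
    · linear_combination -h3
    · ring
end
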